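/- arXiv:2507.01812 — 3 statements merged into one kernel-verified Lean document; each statement's English description precedes it below -/
import Mathlib

section
/- Let ν ≥ 2 and let ν̃ be such that P_ν̃ contains the convex hull of P_ν. Let C ⊂ ℝⁿ be a compact convex set, let f₁, …, f_k be C³ functions on C° each satisfying the ν-barrier conditions on C, and let f_c = λ₁f₁ + … + λ_k f_k be a convex combination (λᵢ ≥ 0, λ₁ + … + λ_k = 1). Then f_c satisfies the ν̃-barrier conditions on C. -/
/-- The body P_ν ⊂ ℝ³ from Corollary 1 (1DequivalenceBody). -/
noncomputable def Pset (ν : ℝ) : Set (ℝ × ℝ × ℝ) :=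
  {q | Real.sqrt (q.2.1 - q.1 ^ 2) / Real.sqrt (ν - 1) ≤ 1 + q.1 ∧
    1 + q.1 ≤ Real.sqrt (ν - 1) * Real.sqrt (q.2.1 - q.1 ^ 2) ∧
    Real.sqrt (q.2.1 - q.1 ^ 2) / Real.sqrt (ν - 1) ≤ 1 - q.1 ∧
    1 - q.1 ≤ Real.sqrt (ν - 1) * Real.sqrt (q.2.1 - q.1 ^ 2) ∧
    |q.2.2 - 6 * q.2.1 * q.1 + 4 * q.1 ^ 3| ≤
      2 * ((ν - 2) / Real.sqrt (ν - 1)) * (q.2.1 - q.1 ^ 2) ^ ((3 : ℝ) / 2)}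
/-- The ν-barrier conditions for a C³ function f on the interior of a compact convex set
C ⊂ ℝⁿ: f''−f'⊗f' positive definite, blow-up at the boundary, and
|f'''[v,v,v] − 6f''[v,v]f'[v] + 4(f'[v])³| ≤ 2γ(f''[v,v] − (f'[v])²)^{3/2}
with γ = (ν−2)/√(ν−1). -/
noncomputable def BarrierCondOn {n : ℕ} (ν : ℝ) (C : Set (EuclideanSpace ℝ (Fin n)))
    (f : EuclideanSpace ℝ (Fin n) → ℝ) : Prop :=
  ContDiffOn ℝ 3 f (interior C) ∧
  (∀ x ∈ interior C, ∀ v : EuclideanSpace ℝ (Fin n), v ≠ 0 →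
    0 < iteratedFDeriv ℝ 2 f x (fun _ => v) - (fderiv ℝ f x v) ^ 2) ∧
  (∀ y ∈ frontier C, Filter.Tendsto f (nhdsWithin y (interior C)) Filter.atTop) ∧
  (∀ x ∈ interior C, ∀ v : EuclideanSpace ℝ (Fin n),
    |iteratedFDeriv ℝ 3 f x (fun _ => v)
        - 6 * iteratedFDeriv ℝ 2 f x (fun _ => v) * fderiv ℝ f x v
        + 4 * (fderiv ℝ f x v) ^ 3| ≤
      2 * ((ν - 2) / Real.sqrt (ν - 1)) *
        (iteratedFDeriv ℝ 2 f x (fun _ => v) - (fderiv ℝ f x v) ^ 2) ^ ((3 : ℝ) / 2))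

section Auxiliary

open Set Filter Topology

/-- A solution of `q' ≥ q ^ 2` that exists on `[0, b)` starts below `1 / b`. -/
theorem le_one_div_of_sq_le_deriv {q q' : ℝ → ℝ} {b : ℝ} (hb : 0 < b)
    (hq : ∀ t ∈ Ico 0 b, HasDerivAt q (q' t) t) (hqq : ∀ t ∈ Ico 0 b, q t ^ 2 ≤ q' t) :
    q 0 ≤ 1 / b := by
  by_contra! hlt
  have h0 : 0 < q 0 := (one_div_pos.2 hb).trans hlt
  have hsub : interior (Ico (0 : ℝ) b) ⊆ Ico 0 b := interior_subset
  have hmono : MonotoneOn q (Ico 0 b) :=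
    monotoneOn_of_deriv_nonneg (convex_Ico 0 b)
      (fun t ht => (hq t ht).continuousAt.continuousWithinAt)
      (fun t ht => (hq t (hsub ht)).differentiableAt.differentiableWithinAt)
      fun t ht => by
        rw [(hq t (hsub ht)).deriv]
        exact (sq_nonneg _).trans (hqq t (hsub ht))
  have hpos : ∀ t ∈ Ico 0 b, 0 < q t := fun t ht =>
    h0.trans_le (hmono (left_mem_Ico.2 hb) ht ht.1)
  have hder : ∀ t ∈ Ico 0 b, HasDerivAt (fun t => (q t)⁻¹ + t) (-q' t / q t ^ 2 + 1) t :=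
    fun t ht => ((hq t ht).inv (hpos t ht).ne').add (hasDerivAt_id t)
  have hanti : AntitoneOn (fun t => (q t)⁻¹ + t) (Ico 0 b) :=
    antitoneOn_of_deriv_nonpos (convex_Ico 0 b)
      (fun t ht => (hder t ht).continuousAt.continuousWithinAt)
      (fun t ht => (hder t (hsub ht)).differentiableAt.differentiableWithinAt)
      fun t ht => by
        rw [(hder t (hsub ht)).deriv, neg_div]
        have := (one_le_div (pow_pos (hpos t (hsub ht)) 2)).2 (hqq t (hsub ht))
        linarith
  have hs : (q 0)⁻¹ ∈ Ico 0 b :=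
    ⟨(inv_pos.2 h0).le, by
      rw [inv_lt_comm₀ h0 hb, ← one_div]; exact hlt⟩
  have := hanti (left_mem_Ico.2 hb) hs hs.1
  have := inv_pos.2 (hpos _ hs)
  simp only [add_zero] at *
  linarith

/-- If `g → ∞` at the right end of `[0, b)` and `g' ≤ q` with `q' ≤ q ^ 2`, then
`q` starts above `1 / b`. -/
theorem one_div_le_of_deriv_le_sq {g p q q' : ℝ → ℝ} {b : ℝ} (hb : 0 < b)
    (hg : ∀ t ∈ Ico 0 b, HasDerivAt g (p t) t) (hpq : ∀ t ∈ Ico 0 b, p t ≤ q t)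
    (hq : ∀ t ∈ Ico 0 b, HasDerivAt q (q' t) t) (hqq : ∀ t ∈ Ico 0 b, q' t ≤ q t ^ 2)
    (hlim : Tendsto g (𝓝[Ico 0 b] b) atTop) :
    1 / b ≤ q 0 := by
  by_contra! hlt
  obtain ⟨c, hbc, hc⟩ : ∃ c, b < c ∧ q 0 ≤ 1 / c := by
    rcases le_or_gt (q 0) 0 with h | h
    · exact ⟨b + 1, by linarith, h.trans (by positivity)⟩
    · exact ⟨1 / q 0, (lt_one_div hb h).2 hlt, by simp⟩
  have hc0 : 0 < c := hb.trans hbc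
  obtain ⟨κ, hκ, hκc⟩ : ∃ κ, 1 < κ ∧ κ * b < c := by
    obtain ⟨κ, h1, h2⟩ := exists_between ((one_lt_div hb).2 hbc)
    exact ⟨κ, h1, (lt_div_iff₀ hb).1 h2⟩
  have hden : ∀ t ≤ b, c - κ * b ≤ c - κ * t := fun t ht => by nlinarith
  have hcb : 0 < c - κ * b := by linarith
  have hB : ∀ t ≤ b, HasDerivAt (fun t => (c - κ * t)⁻¹) (κ * ((c - κ * t)⁻¹) ^ 2) t := by
    intro t ht
    have hne : c - κ * t ≠ 0 := (hcb.trans_le (hden t ht)).ne'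
    convert! (((hasDerivAt_id t).const_mul κ).const_sub c).inv hne using 1
    simp only [id]
    field_simp
  have hqB : ∀ s ∈ Ico 0 b, q s ≤ (c - κ * b)⁻¹ := by
    intro s hs
    have hsub : ∀ t ∈ Icc 0 s, t ∈ Ico 0 b := fun t ht => ⟨ht.1, ht.2.trans_lt hs.2⟩
    refine (image_le_of_deriv_right_lt_deriv_boundary' (a := 0) (b := s) (f := q) (f' := q')
      (B := fun t => (c - κ * t)⁻¹) (B' := fun t => κ * ((c - κ * t)⁻¹) ^ 2)
      (fun t ht => (hq t (hsub t ht)).continuousAt.continuousWithinAt)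
      (fun t ht => (hq t (hsub t (Ico_subset_Icc_self ht))).hasDerivWithinAt)
      (by simpa using hc)
      (fun t ht => (hB t (hsub t ht).2.le).continuousAt.continuousWithinAt)
      (fun t ht => (hB t (hsub t (Ico_subset_Icc_self ht)).2.le).hasDerivWithinAt)
      (fun t ht hEq => ?_) (right_mem_Icc.2 hs.1)).trans ?_
    · have ht' := hsub t (Ico_subset_Icc_self ht)
      have h1 := hqq t ht'
      have h2 : 0 < (c - κ * t)⁻¹ := inv_pos.2 (hcb.trans_le (hden t ht'.2.le))
      rw [hEq] at h1
      nlinarith [pow_pos h2 2]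
    · exact inv_anti₀ hcb (hden s hs.2.le)
  set M := (c - κ * b)⁻¹
  have hM : 0 < M := inv_pos.2 hcb
  have hgM : ∀ s ∈ Ico 0 b, g s ≤ g 0 + M * b := by
    intro s hs
    have := (convex_Ico 0 b).image_sub_le_mul_sub_of_deriv_le (f := g) (C := M)
      (fun t ht => (hg t ht).continuousAt.continuousWithinAt)
      (fun t ht => (hg t (interior_subset ht)).differentiableAt.differentiableWithinAt)
      (fun t ht => by
        have ht := interior_subset ht
        rw [(hg t ht).deriv]
        exact (hpq t ht).trans (hqB t ht)) 0 (left_mem_Ico.2 hb) s hs hs.1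
    nlinarith [hs.2]
  have : (𝓝[Ico 0 b] b).NeBot := by
    rw [← mem_closure_iff_nhdsWithin_neBot, closure_Ico hb.ne]
    exact right_mem_Icc.2 hb.le
  obtain ⟨s, hs, hs'⟩ :=
    ((hlim.eventually_gt_atTop (g 0 + M * b)).and self_mem_nhdsWithin).exists
  exact (hgM s hs').not_gt hs

/-- The bounds on the derivative at `0` of a function on `[0, b)` that satisfies the
one-dimensional barrier conditions, where `ρ = √(ν - 1)`. -/
theorem barrier_bounds {g g₁ g₂ g₃ : ℝ → ℝ} {b ρ : ℝ} (hb : 0 < b) (hρ : 1 ≤ ρ)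
    (hg : ∀ t ∈ Ico 0 b, HasDerivAt g (g₁ t) t) (hg₁ : ∀ t ∈ Ico 0 b, HasDerivAt g₁ (g₂ t) t)
    (hg₂ : ∀ t ∈ Ico 0 b, HasDerivAt g₂ (g₃ t) t)
    (hpos : ∀ t ∈ Ico 0 b, 0 < g₂ t - g₁ t ^ 2)
    (hthird : ∀ t ∈ Ico 0 b, |g₃ t - 6 * g₂ t * g₁ t + 4 * g₁ t ^ 3| ≤
      2 * ((ρ ^ 2 - 1) / ρ) * √(g₂ t - g₁ t ^ 2) ^ 3)
    (hlim : Tendsto g (𝓝[Ico 0 b] b) atTop) :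
    √(g₂ 0 - g₁ 0 ^ 2) / ρ ≤ 1 / b - g₁ 0 ∧ 1 / b - g₁ 0 ≤ ρ * √(g₂ 0 - g₁ 0 ^ 2) := by
  have hρ0 : 0 < ρ := by linarith
  set h : ℝ → ℝ := fun t => √(g₂ t - g₁ t ^ 2) with h_def
  have hh0 : ∀ t ∈ Ico 0 b, 0 < h t := fun t ht => Real.sqrt_pos.2 (hpos t ht)
  have hsq : ∀ t ∈ Ico 0 b, g₂ t = h t ^ 2 + g₁ t ^ 2 := fun t ht => by
    rw [h_def]; simp only; rw [Real.sq_sqrt (hpos t ht).le]; ring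
  set h' : ℝ → ℝ := fun t => (g₃ t - 2 * g₁ t * g₂ t) / (2 * h t) with h'_def
  have hh : ∀ t ∈ Ico 0 b, HasDerivAt h (h' t) t := fun t ht => by
    convert! ((hg₂ t ht).sub ((hg₁ t ht).pow 2)).sqrt (hpos t ht).ne' using 1
    simp [h'_def, h_def]
  have hbd : ∀ t ∈ Ico 0 b, |h' t - 2 * g₁ t * h t| ≤ (ρ - 1 / ρ) * h t ^ 2 := fun t ht => by
    have h3 := hthird t ht
    have e1 : g₃ t - 6 * g₂ t * g₁ t + 4 * g₁ t ^ 3 = (2 * h t) * (h' t - 2 * g₁ t * h t) := by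
      have := (hh0 t ht).ne'
      simp only [h'_def]
      field_simp
      rw [hsq t ht]; ring
    have e2 : 2 * ((ρ ^ 2 - 1) / ρ) * √(g₂ t - g₁ t ^ 2) ^ 3
        = (2 * h t) * ((ρ - 1 / ρ) * h t ^ 2) := by
      change 2 * ((ρ ^ 2 - 1) / ρ) * h t ^ 3 = _
      field_simp
    have h2 : 0 < 2 * h t := by linarith [hh0 t ht]
    rw [e1, e2, abs_mul, abs_of_pos h2] at h3
    exact le_of_mul_le_mul_left h3 h2
  have hq : ∀ c : ℝ, ∀ t ∈ Ico 0 b,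
      HasDerivAt (fun t => g₁ t + c * h t) (g₂ t + c * h' t) t := fun c t ht =>
    (hg₁ t ht).add ((hh t ht).const_mul c)
  have hlow := le_one_div_of_sq_le_deriv hb (hq (1 / ρ)) fun t ht => by
    have h1 := (abs_le.1 (hbd t ht)).1
    have h2 := mul_le_mul_of_nonneg_left h1 (one_div_pos.2 hρ0).le
    have e : 1 / ρ * -((ρ - 1 / ρ) * h t ^ 2) = - h t ^ 2 + (1 / ρ) ^ 2 * h t ^ 2 := by
      field_simp
      ring
    rw [e] at h2
    rw [hsq t ht]
    linear_combination h2
  have hup := one_div_le_of_deriv_le_sq hb hg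
    (fun t ht => le_add_of_nonneg_right (mul_pos hρ0 (hh0 t ht)).le) (hq ρ) (fun t ht => by
      have h1 := (abs_le.1 (hbd t ht)).2
      have h2 := mul_le_mul_of_nonneg_left h1 hρ0.le
      have e : ρ * ((ρ - 1 / ρ) * h t ^ 2) = ρ ^ 2 * h t ^ 2 - h t ^ 2 := by
        field_simp
      rw [e] at h2
      rw [hsq t ht]
      linear_combination h2) hlim
  change h 0 / ρ ≤ 1 / b - g₁ 0 ∧ 1 / b - g₁ 0 ≤ ρ * h 0
  constructor
  · have : 1 / ρ * h 0 = h 0 / ρ := by ring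
    linarith
  · linarith

/-- A ray from an interior point of a compact convex set leaves through the frontier. -/
theorem exists_exit_time {E : Type*} [NormedAddCommGroup E] [NormedSpace ℝ E]
    {C : Set E} (hC : IsCompact C) (hconv : Convex ℝ C) {x v : E}
    (hx : x ∈ interior C) (hv : v ≠ 0) :
    ∃ b : ℝ, 0 < b ∧ x + b • v ∈ frontier C ∧ ∀ t ∈ Ico 0 b, x + t • v ∈ interior C := by
  have hemb : IsClosedEmbedding fun t : ℝ => x + t • v :=
    (Homeomorph.addLeft x).isClosedEmbedding.comp (isClosedEmbedding_smul_left hv)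
  have hK : IsCompact ((fun t : ℝ => x + t • v) ⁻¹' C) := hemb.isCompact_preimage hC
  have h0 : (0 : ℝ) ∈ (fun t : ℝ => x + t • v) ⁻¹' C := by simpa using interior_subset hx
  obtain ⟨b, hbC, hmax⟩ := hK.exists_isGreatest ⟨0, h0⟩
  have hfr : x + b • v ∈ frontier C := by
    rw [hC.isClosed.frontier_eq]
    refine ⟨hbC, fun hint => ?_⟩
    have h1 : ∀ᶠ t in 𝓝 b, x + t • v ∈ interior C :=
      hemb.continuous.continuousAt.eventually (isOpen_interior.mem_nhds hint)
    obtain ⟨t, ht, hbt⟩ := ((h1.filter_mono nhdsWithin_le_nhds).and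
      (self_mem_nhdsWithin : Ioi b ∈ 𝓝[>] b)).exists
    exact (hmax (show x + t • v ∈ C from interior_subset ht)).not_gt hbt
  have hb : 0 < b := by
    refine lt_of_le_of_ne (hmax h0) ?_
    rintro rfl
    exact hfr.2 (by simpa using hx)
  refine ⟨b, hb, hfr, fun t ht => ?_⟩
  convert hconv.combo_interior_self_mem_interior hx hbC (a := 1 - t / b) (b := t / b)
    (by rw [sub_pos, div_lt_one hb]; exact ht.2) (div_nonneg ht.1 hb.le) (by ring) using 1
  have : t / b * b = t := by field_simp
  simp only [sub_smul, one_smul, smul_add, smul_smul, this]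
  abel

/-- The iterated directional derivatives along a line are each other's derivatives. -/
theorem hasDerivAt_iteratedFDeriv_line {E : Type*} [NormedAddCommGroup E] [NormedSpace ℝ E]
    {f : E → ℝ} {x v : E} {m : ℕ} {t : ℝ}
    (hf : ContDiffAt ℝ 3 f (x + t • v)) (hm : m < 3) :
    HasDerivAt (fun s : ℝ => iteratedFDeriv ℝ m f (x + s • v) fun _ => v)
      (iteratedFDeriv ℝ (m + 1) f (x + t • v) fun _ => v) t := by
  have hd := hf.differentiableAt_iteratedFDeriv (m := m) (by exact_mod_cast hm)
  have hl : HasDerivAt (fun s : ℝ => x + s • v) v t := by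
    simpa using ((hasDerivAt_id t).smul_const v).const_add x
  have h1 := (hd.continuousMultilinear_apply_const fun _ => v).hasFDerivAt.comp_hasDerivAt t hl
  convert! h1 using 1
  exact hd.iteratedFDeriv_succ_apply_left'

theorem rpow_three_halves {a : ℝ} (ha : 0 ≤ a) : a ^ ((3 : ℝ) / 2) = √a ^ 3 := by
  rw [Real.sqrt_eq_rpow, ← Real.rpow_natCast, ← Real.rpow_mul ha]
  norm_num

/-- The bounds on the directional derivative in terms of the exit time `b`. -/
theorem BarrierCondOn.bounds {n : ℕ} {ν : ℝ} (hν : 2 ≤ ν) {C : Set (EuclideanSpace ℝ (Fin n))}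
    {f : EuclideanSpace ℝ (Fin n) → ℝ} (hf : BarrierCondOn ν C f)
    {x v : EuclideanSpace ℝ (Fin n)} (hv : v ≠ 0) {b : ℝ} (hb : 0 < b)
    (hfr : x + b • v ∈ frontier C) (hint : ∀ t ∈ Ico 0 b, x + t • v ∈ interior C) :
    √(iteratedFDeriv ℝ 2 f x (fun _ => v) - (fderiv ℝ f x v) ^ 2) / √(ν - 1)
        ≤ 1 / b - fderiv ℝ f x v ∧
      1 / b - fderiv ℝ f x v
        ≤ √(ν - 1) * √(iteratedFDeriv ℝ 2 f x (fun _ => v) - (fderiv ℝ f x v) ^ 2) := by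
  obtain ⟨hsm, hpos, hlim, hthird⟩ := hf
  have hcd : ∀ t ∈ Ico 0 b, ContDiffAt ℝ 3 f (x + t • v) := fun t ht =>
    hsm.contDiffAt (isOpen_interior.mem_nhds (hint t ht))
  have hder : ∀ m < 3, ∀ t ∈ Ico 0 b, HasDerivAt
      (fun s : ℝ => iteratedFDeriv ℝ m f (x + s • v) fun _ => v)
      (iteratedFDeriv ℝ (m + 1) f (x + t • v) fun _ => v) t := fun m hm t ht =>
    hasDerivAt_iteratedFDeriv_line (hcd t ht) hm
  have hsq : √(ν - 1) ^ 2 - 1 = ν - 2 := by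
    rw [Real.sq_sqrt (by linarith)]; ring
  have key := barrier_bounds (ρ := √(ν - 1)) hb (Real.one_le_sqrt.2 (by linarith))
    (hder 0 (by norm_num)) (hder 1 (by norm_num)) (hder 2 (by norm_num))
    (fun t ht => by simpa using hpos _ (hint t ht) v hv)
    (fun t ht => by
      have h := hthird _ (hint t ht) v
      rw [rpow_three_halves (hpos _ (hint t ht) v hv).le] at h
      simpa [hsq] using h)
    (by
      have hc : Continuous fun t : ℝ => x + t • v := by fun_prop
      simpa [Function.comp_def] using
        (hlim _ hfr).comp (hc.continuousWithinAt.tendsto_nhdsWithin hint))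
  simpa using key

/-- The action of `t ↦ α t / (1 + β t)` on the values at `0` of the first three derivatives of
`f (φ t) - log (1 + β t)`. -/
def jetMap (α β : ℝ) (y : ℝ × ℝ × ℝ) : ℝ × ℝ × ℝ :=
  (α * y.1 - β, α ^ 2 * y.2.1 - 2 * α * β * y.1 + β ^ 2,
    α ^ 3 * y.2.2 - 6 * α ^ 2 * β * y.2.1 + 6 * α * β ^ 2 * y.1 - 2 * β ^ 3)

theorem jetMap_sum {ι : Type*} {s : Finset ι} {w : ι → ℝ} (hw : ∑ i ∈ s, w i = 1) (α β : ℝ)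
    (y : ι → ℝ × ℝ × ℝ) :
    jetMap α β (∑ i ∈ s, w i • y i) = ∑ i ∈ s, w i • jetMap α β (y i) := by
  have hconst : ∀ c : ℝ, c = ∑ i ∈ s, w i * c := fun c => by rw [← Finset.sum_mul, hw, one_mul]
  simp only [jetMap, Prod.ext_iff, Prod.fst_sum, Prod.snd_sum, Prod.smul_fst, Prod.smul_snd,
    smul_eq_mul]
  refine ⟨?_, ?_, ?_⟩
  · conv_lhs => rw [hconst β, Finset.mul_sum, ← Finset.sum_sub_distrib]
    exact Finset.sum_congr rfl fun i _ => by ring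
  · conv_lhs => rw [hconst (β ^ 2)]
    simp only [Finset.mul_sum, ← Finset.sum_sub_distrib, ← Finset.sum_add_distrib]
    exact Finset.sum_congr rfl fun i _ => by ring
  · conv_lhs => rw [hconst (2 * β ^ 3)]
    simp only [Finset.mul_sum, ← Finset.sum_sub_distrib, ← Finset.sum_add_distrib]
    exact Finset.sum_congr rfl fun i _ => by ring

theorem jetMap_variance (α β : ℝ) (y : ℝ × ℝ × ℝ) :
    (jetMap α β y).2.1 - (jetMap α β y).1 ^ 2 = α ^ 2 * (y.2.1 - y.1 ^ 2) := by
  simp only [jetMap]; ring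

theorem jetMap_cubic (α β : ℝ) (y : ℝ × ℝ × ℝ) :
    (jetMap α β y).2.2 - 6 * (jetMap α β y).2.1 * (jetMap α β y).1 + 4 * (jetMap α β y).1 ^ 3 =
      α ^ 3 * (y.2.2 - 6 * y.2.1 * y.1 + 4 * y.1 ^ 3) := by
  simp only [jetMap]; ring

theorem jetMap_third_bound_iff {α : ℝ} (hα : 0 < α) (β κ : ℝ) {y : ℝ × ℝ × ℝ}
    (hy : 0 ≤ y.2.1 - y.1 ^ 2) :
    |(jetMap α β y).2.2 - 6 * (jetMap α β y).2.1 * (jetMap α β y).1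
        + 4 * (jetMap α β y).1 ^ 3| ≤
      κ * ((jetMap α β y).2.1 - (jetMap α β y).1 ^ 2) ^ ((3 : ℝ) / 2) ↔
    |y.2.2 - 6 * y.2.1 * y.1 + 4 * y.1 ^ 3| ≤ κ * (y.2.1 - y.1 ^ 2) ^ ((3 : ℝ) / 2) := by
  have e : κ * (α ^ 2 * (y.2.1 - y.1 ^ 2)) ^ ((3 : ℝ) / 2) =
      α ^ 3 * (κ * (y.2.1 - y.1 ^ 2) ^ ((3 : ℝ) / 2)) := by
    rw [rpow_three_halves (by positivity), rpow_three_halves hy, Real.sqrt_mul (by positivity),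
      Real.sqrt_sq hα.le]
    ring
  rw [jetMap_variance, jetMap_cubic, abs_mul, abs_of_pos (pow_pos hα 3), e]
  exact mul_le_mul_iff_right₀ (pow_pos hα 3)

theorem jetMap_mem_Pset {ν α β a b : ℝ} (hα : 0 < α) (ha : 1 - β = α * (1 / a))
    (hb : 1 + β = α * (1 / b)) {y : ℝ × ℝ × ℝ} (hy : 0 ≤ y.2.1 - y.1 ^ 2)
    (hya : √(y.2.1 - y.1 ^ 2) / √(ν - 1) ≤ 1 / a + y.1 ∧
      1 / a + y.1 ≤ √(ν - 1) * √(y.2.1 - y.1 ^ 2))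
    (hyb : √(y.2.1 - y.1 ^ 2) / √(ν - 1) ≤ 1 / b - y.1 ∧
      1 / b - y.1 ≤ √(ν - 1) * √(y.2.1 - y.1 ^ 2))
    (hthird : |y.2.2 - 6 * y.2.1 * y.1 + 4 * y.1 ^ 3| ≤
      2 * ((ν - 2) / √(ν - 1)) * (y.2.1 - y.1 ^ 2) ^ ((3 : ℝ) / 2)) :
    jetMap α β y ∈ Pset ν := by
  have hsqrt : √((jetMap α β y).2.1 - (jetMap α β y).1 ^ 2) = α * √(y.2.1 - y.1 ^ 2) := by
    rw [jetMap_variance, Real.sqrt_mul (by positivity), Real.sqrt_sq hα.le]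
  have el : 1 + (jetMap α β y).1 = α * (1 / a + y.1) := by
    simp only [jetMap]; linear_combination ha
  have er : 1 - (jetMap α β y).1 = α * (1 / b - y.1) := by
    simp only [jetMap]; linear_combination hb
  refine ⟨?_, ?_, ?_, ?_, (jetMap_third_bound_iff hα β _ hy).2 hthird⟩
  · rw [hsqrt, el, mul_div_assoc]
    exact mul_le_mul_of_nonneg_left hya.1 hα.le
  · rw [hsqrt, el, mul_left_comm]
    exact mul_le_mul_of_nonneg_left hya.2 hα.le
  · rw [hsqrt, er, mul_div_assoc]
    exact mul_le_mul_of_nonneg_left hyb.1 hα.le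
  · rw [hsqrt, er, mul_left_comm]
    exact mul_le_mul_of_nonneg_left hyb.2 hα.le

theorem iteratedFDeriv_convex_comb {E : Type*} [NormedAddCommGroup E] [NormedSpace ℝ E]
    {ι : Type*} {s : Finset ι} {w : ι → ℝ} {f : ι → E → ℝ} {x : E} {m : ℕ}
    (hf : ∀ i ∈ s, ContDiffAt ℝ m (f i) x) (v : Fin m → E) :
    iteratedFDeriv ℝ m (fun x => ∑ i ∈ s, w i * f i x) x v =
      ∑ i ∈ s, w i * iteratedFDeriv ℝ m (f i) x v := by
  have h := iteratedFDeriv_fun_sum_apply (u := s) (f := fun i x => w i • f i x) (x := x) (n := m)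
    (𝕜 := ℝ) fun i hi => (hf i hi).const_smul (w i)
  simp only [smul_eq_mul] at h
  rw [h, _root_.sum_apply]
  refine Finset.sum_congr rfl fun i hi => ?_
  have := iteratedFDeriv_const_smul_apply' (a := w i) (hf i hi)
  simp only [smul_eq_mul] at this
  rw [this]
  rfl

/-- A convex combination of functions tending to `∞` tends to `∞`. -/
theorem tendsto_convex_comb_atTop {α ι : Type*} [Fintype ι] {l : Filter α} {w : ι → ℝ}
    {f : ι → α → ℝ} (hw : ∀ i, 0 ≤ w i) (hsum : ∑ i, w i = 1)
    (hf : ∀ i, Tendsto (f i) l atTop) : Tendsto (fun x => ∑ i, w i * f i x) l atTop := by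
  obtain ⟨j, -, hj⟩ : ∃ j ∈ Finset.univ, 0 < w j :=
    Finset.exists_lt_of_sum_lt (by simp [hsum])
  refine tendsto_atTop_mono' l ?_ ((hf j).const_mul_atTop hj)
  filter_upwards [eventually_all.2 fun i => (hf i).eventually_ge_atTop 0] with x hx
  exact Finset.single_le_sum (f := fun i => w i * f i x)
    (fun i _ => mul_nonneg (hw i) (hx i)) (Finset.mem_univ j)

/-- The variance of a convex combination of jets of positive variance is positive. -/
theorem sum_variance_pos {ι : Type*} [Fintype ι] {w y₁ y₂ : ι → ℝ} (hw : ∀ i, 0 ≤ w i)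
    (hsum : ∑ i, w i = 1) (hy : ∀ i, 0 < y₂ i - y₁ i ^ 2) :
    0 < ∑ i, w i * y₂ i - (∑ i, w i * y₁ i) ^ 2 := by
  have hJ : (∑ i, w i * y₁ i) ^ 2 ≤ ∑ i, w i * y₁ i ^ 2 := by
    simpa using (even_two.convexOn_pow (𝕜 := ℝ)).map_sum_le (t := Finset.univ) (w := w) (p := y₁)
      (fun i _ => hw i) hsum fun i _ => mem_univ _
  obtain ⟨j, -, hj⟩ : ∃ j ∈ Finset.univ, 0 < w j :=
    Finset.exists_lt_of_sum_lt (by simp [hsum])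
  have hlt : ∑ i, w i * y₁ i ^ 2 < ∑ i, w i * y₂ i :=
    Finset.sum_lt_sum (fun i _ => mul_le_mul_of_nonneg_left (sub_pos.1 (hy i)).le (hw i))
      ⟨j, Finset.mem_univ j, mul_lt_mul_of_pos_left (sub_pos.1 (hy j)) hj⟩
  linarith

end Auxiliary

/-- If P_ν̃ contains the convex hull of P_ν, then any convex combination of
C³ functions satisfying the ν-barrier conditions on a compact convex set C satisfies the
ν̃-barrier conditions on C. -/
theorem stmt_12 {n : ℕ} (ν νt : ℝ) (hν : 2 ≤ ν) (hνt : 2 ≤ νt)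
    (hP : convexHull ℝ (Pset ν) ⊆ Pset νt)
    (C : Set (EuclideanSpace ℝ (Fin n))) (hCcpt : IsCompact C) (hCconv : Convex ℝ C)
    (k : ℕ) (f : Fin k → EuclideanSpace ℝ (Fin n) → ℝ)
    (hf : ∀ i, BarrierCondOn ν C (f i))
    (lam : Fin k → ℝ) (hlam : ∀ i, 0 ≤ lam i) (hsum : ∑ i, lam i = 1) :
    BarrierCondOn νt C (fun x => ∑ i, lam i * f i x) := by
  have hat : ∀ x ∈ interior C, ∀ i, ContDiffAt ℝ 3 (f i) x := fun x hx i =>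
    (hf i).1.contDiffAt (isOpen_interior.mem_nhds hx)
  have hD2 : ∀ x ∈ interior C, ∀ v : EuclideanSpace ℝ (Fin n),
      iteratedFDeriv ℝ 2 (fun x => ∑ i, lam i * f i x) x (fun _ => v) =
        ∑ i, lam i * iteratedFDeriv ℝ 2 (f i) x fun _ => v := fun x hx v =>
    iteratedFDeriv_convex_comb (fun i _ => (hat x hx i).of_le (by norm_num)) _
  have hD3 : ∀ x ∈ interior C, ∀ v : EuclideanSpace ℝ (Fin n),
      iteratedFDeriv ℝ 3 (fun x => ∑ i, lam i * f i x) x (fun _ => v) =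
        ∑ i, lam i * iteratedFDeriv ℝ 3 (f i) x fun _ => v := fun x hx v =>
    iteratedFDeriv_convex_comb (fun i _ => hat x hx i) _
  have hD1 : ∀ x ∈ interior C, ∀ v : EuclideanSpace ℝ (Fin n),
      fderiv ℝ (fun x => ∑ i, lam i * f i x) x v = ∑ i, lam i * fderiv ℝ (f i) x v :=
    fun x hx v => by
      simpa using iteratedFDeriv_convex_comb (s := Finset.univ) (w := lam) (m := 1)
        (fun i _ => (hat x hx i).of_le (by norm_num)) fun _ => v
  refine ⟨ContDiffOn.sum fun i _ => contDiffOn_const.mul (hf i).1, fun x hx v hv => ?_,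
    fun y hy => tendsto_convex_comb_atTop hlam hsum fun i => (hf i).2.2.1 y hy,
    fun x hx v => ?_⟩
  · rw [hD2 x hx, hD1 x hx]
    exact sum_variance_pos hlam hsum fun i => (hf i).2.1 x hx v hv
  rcases eq_or_ne v 0 with rfl | hv
  · have hz : ∀ m : ℕ, iteratedFDeriv ℝ (m + 1) (fun x => ∑ i, lam i * f i x) x (fun _ => 0) = 0 :=
      fun m => ContinuousMultilinearMap.map_zero _
    simp only [hz 1, hz 2, map_zero]
    norm_num
  obtain ⟨b, hb, hbfr, hbint⟩ := exists_exit_time hCcpt hCconv hx hv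
  obtain ⟨a, ha, hafr, haint⟩ := exists_exit_time hCcpt hCconv hx (neg_ne_zero.2 hv)
  have hα : 0 < 2 * a * b / (a + b) := by positivity
  have hβa : 1 - (a - b) / (a + b) = 2 * a * b / (a + b) * (1 / a) := by field_simp; ring
  have hβb : 1 + (a - b) / (a + b) = 2 * a * b / (a + b) * (1 / b) := by field_simp; ring
  set y : Fin k → ℝ × ℝ × ℝ := fun i => (fderiv ℝ (f i) x v,
    iteratedFDeriv ℝ 2 (f i) x (fun _ => v), iteratedFDeriv ℝ 3 (f i) x fun _ => v) with hy
  have hmem : ∀ i, jetMap (2 * a * b / (a + b)) ((a - b) / (a + b)) (y i) ∈ Pset ν := fun i => by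
    refine jetMap_mem_Pset hα hβa hβb ((hf i).2.1 x hx v hv).le ?_
      ((hf i).bounds hν hv hb hbfr hbint) ((hf i).2.2.2 x hx v)
    have hneg : iteratedFDeriv ℝ 2 (f i) x (fun _ => -v) =
        iteratedFDeriv ℝ 2 (f i) x fun _ => v := by
      simpa using (iteratedFDeriv ℝ 2 (f i) x).map_smul_univ (fun _ => (-1 : ℝ)) fun _ => v
    have h := (hf i).bounds hν (neg_ne_zero.2 hv) ha hafr haint
    rwa [hneg, map_neg, neg_sq, sub_neg_eq_add] at h
  have hsum_mem : jetMap (2 * a * b / (a + b)) ((a - b) / (a + b)) (∑ i, lam i • y i) ∈ Pset νt := by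
    rw [jetMap_sum hsum]
    exact hP ((convex_convexHull ℝ _).sum_mem (fun i _ => hlam i) hsum
      fun i _ => subset_convexHull ℝ _ (hmem i))
  have hjet : ∑ i, lam i • y i = (fderiv ℝ (fun x => ∑ i, lam i * f i x) x v,
      iteratedFDeriv ℝ 2 (fun x => ∑ i, lam i * f i x) x (fun _ => v),
      iteratedFDeriv ℝ 3 (fun x => ∑ i, lam i * f i x) x fun _ => v) := by
    rw [hD1 x hx, hD2 x hx, hD3 x hx]
    simp [hy, Prod.ext_iff, Prod.fst_sum, Prod.snd_sum]
  rw [hjet] at hsum_mem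
  refine (jetMap_third_bound_iff hα _ _ ?_).1 hsum_mem.2.2.2.2
  simp only [hD1 x hx, hD2 x hx]
  exact (sum_variance_pos hlam hsum fun i => (hf i).2.1 x hx v hv).le
end

section
/- Let Γ ⊂ ℝ^{m} be a compact set and let γ_min, γ_max : Γ → ℝ be bounded functions with γ_max − γ_min ≥ 0. Suppose that for every x in the interior of Γ there exists a segment I ⊆ Γ linking two boundary points of Γ and containing x on which γ_min is concave, and a similar segment I' on which γ_max is convex. Then the convex hull of the set Ξ = {(x,t) ∈ ℝ^{m+1} : x ∈ Γ, γ_min(x) ≤ t ≤ γ_max(x)} equals the convex hull of the set Ξ' = {(x,t) ∈ ℝ^{m+1} : x ∈ ∂Γ, t ∈ {γ_min(x), γ_max(x)}}. -/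
/-- The fibre of a convex set in `E × ℝ` over a point is order-connected. -/
theorem Convex.mem_of_fibre_le_of_le {E : Type*} [AddCommGroup E] [Module ℝ E]
    {C : Set (E × ℝ)} (hC : Convex ℝ C) {x : E} {s t u : ℝ}
    (hs : (x, s) ∈ C) (hu : (x, u) ∈ C) (hst : s ≤ t) (htu : t ≤ u) : (x, t) ∈ C := by
  have ht : t ∈ segment ℝ s u := by
    rw [segment_eq_Icc (hst.trans htu)]
    exact ⟨hst, htu⟩
  apply hC.segment_subset hs hu
  rw [← Prod.image_mk_segment_right]
  exact ⟨t, ht, rfl⟩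

/-- If a convex set contains the endpoints of the graph of a concave function on a segment,
then over every point of the segment it contains a point below the graph. -/
theorem ConcaveOn.exists_mem_le_of_mem_segment {E : Type*} [AddCommGroup E] [Module ℝ E]
    {C : Set (E × ℝ)} (hC : Convex ℝ C) {f : E → ℝ} {a b x : E}
    (hf : ConcaveOn ℝ (segment ℝ a b) f) (hx : x ∈ segment ℝ a b)
    (ha : (a, f a) ∈ C) (hb : (b, f b) ∈ C) : ∃ s ≤ f x, (x, s) ∈ C := by
  obtain ⟨α, β, hα, hβ, hαβ, rfl⟩ := hx
  exact ⟨α • f a + β • f b,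
    hf.2 (left_mem_segment ℝ a b) (right_mem_segment ℝ a b) hα hβ hαβ,
    hC ha hb hα hβ hαβ⟩

/-- If a convex set contains the endpoints of the graph of a convex function on a segment,
then over every point of the segment it contains a point above the graph. -/
theorem ConvexOn.exists_mem_ge_of_mem_segment {E : Type*} [AddCommGroup E] [Module ℝ E]
    {C : Set (E × ℝ)} (hC : Convex ℝ C) {f : E → ℝ} {a b x : E}
    (hf : ConvexOn ℝ (segment ℝ a b) f) (hx : x ∈ segment ℝ a b)
    (ha : (a, f a) ∈ C) (hb : (b, f b) ∈ C) : ∃ u, f x ≤ u ∧ (x, u) ∈ C := by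
  obtain ⟨α, β, hα, hβ, hαβ, rfl⟩ := hx
  exact ⟨α • f a + β • f b,
    hf.2 (left_mem_segment ℝ a b) (right_mem_segment ℝ a b) hα hβ hαβ,
    hC ha hb hα hβ hαβ⟩


/-- Let Γ ⊂ ℝᵐ be compact, γ_min, γ_max bounded on Γ with γ_min ≤ γ_max,
and suppose every interior point of Γ lies on a segment linking two boundary points of Γ
on which γ_min is concave, and on one on which γ_max is convex. Then the convex hull of
Ξ = {(x,t) : x ∈ Γ, γ_min(x) ≤ t ≤ γ_max(x)} equals the convex hull of
Ξ' = {(x,t) : x ∈ ∂Γ, t ∈ {γ_min(x), γ_max(x)}}. -/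
theorem stmt_13 {m : ℕ} (Γ : Set (EuclideanSpace ℝ (Fin m))) (hΓ : IsCompact Γ)
    (γmin γmax : EuclideanSpace ℝ (Fin m) → ℝ)
    (hbdd : ∃ M : ℝ, ∀ x ∈ Γ, |γmin x| ≤ M ∧ |γmax x| ≤ M)
    (hle : ∀ x ∈ Γ, γmin x ≤ γmax x)
    (hconc : ∀ x ∈ interior Γ, ∃ a b : EuclideanSpace ℝ (Fin m),
      a ∈ frontier Γ ∧ b ∈ frontier Γ ∧ segment ℝ a b ⊆ Γ ∧ x ∈ segment ℝ a b ∧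
      ConcaveOn ℝ (segment ℝ a b) γmin)
    (hconv : ∀ x ∈ interior Γ, ∃ a b : EuclideanSpace ℝ (Fin m),
      a ∈ frontier Γ ∧ b ∈ frontier Γ ∧ segment ℝ a b ⊆ Γ ∧ x ∈ segment ℝ a b ∧
      ConvexOn ℝ (segment ℝ a b) γmax) :
    convexHull ℝ {q : EuclideanSpace ℝ (Fin m) × ℝ |
        q.1 ∈ Γ ∧ γmin q.1 ≤ q.2 ∧ q.2 ≤ γmax q.1} =
      convexHull ℝ {q : EuclideanSpace ℝ (Fin m) × ℝ |
        q.1 ∈ frontier Γ ∧ (q.2 = γmin q.1 ∨ q.2 = γmax q.1)} := by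
  apply Set.Subset.antisymm
  · refine convexHull_min ?_ (convex_convexHull ℝ _)
    rintro ⟨x, t⟩ ⟨hx, hmin, hmax⟩
    set C := convexHull ℝ {q : EuclideanSpace ℝ (Fin m) × ℝ |
      q.1 ∈ frontier Γ ∧ (q.2 = γmin q.1 ∨ q.2 = γmax q.1)}
    have hC : Convex ℝ C := convex_convexHull ℝ _
    have hCmin : ∀ y ∈ frontier Γ, (y, γmin y) ∈ C := fun y hy =>
      subset_convexHull ℝ _ ⟨hy, Or.inl rfl⟩
    have hCmax : ∀ y ∈ frontier Γ, (y, γmax y) ∈ C := fun y hy =>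
      subset_convexHull ℝ _ ⟨hy, Or.inr rfl⟩
    by_cases hint : x ∈ interior Γ
    · obtain ⟨a, b, ha, hb, -, hxab, hf⟩ := hconc x hint
      obtain ⟨c, d, hc, hd, -, hxcd, hg⟩ := hconv x hint
      obtain ⟨s, hs, hsC⟩ :=
        hf.exists_mem_le_of_mem_segment hC hxab (hCmin a ha) (hCmin b hb)
      obtain ⟨u, hu, huC⟩ :=
        hg.exists_mem_ge_of_mem_segment hC hxcd (hCmax c hc) (hCmax d hd)
      exact hC.mem_of_fibre_le_of_le hsC huC (hs.trans hmin) (hmax.trans hu)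
    · have hfr : x ∈ frontier Γ := ⟨subset_closure hx, hint⟩
      exact hC.mem_of_fibre_le_of_le (hCmin x hfr) (hCmax x hfr) hmin hmax
  · refine convexHull_mono ?_
    rintro q ⟨hq, ht⟩
    have hle_q := hle q.1 (hΓ.isClosed.frontier_subset hq)
    refine ⟨hΓ.isClosed.frontier_subset hq, ?_⟩
    rcases ht with ht | ht <;> rw [ht]
    · exact ⟨le_rfl, hle_q⟩
    · exact ⟨hle_q, le_rfl⟩
end

section
/- Let ν > 2, γ = (ν−2)/√(ν−1), and let t₋ < 0 and t₊ > 1 be real numbers. Define Γ = {(p₀, g₀) ∈ ℝ² : g₀/√(ν−1) ≤ p₀ − 1/t₋ ≤ √(ν−1)·g₀ and g₀/√(ν−1) ≤ −p₀ + 1/t₊ ≤ √(ν−1)·g₀} and γ_max(p₀,g₀) = (g₀² − p₀² + p₀ − γ g₀ p₀)/(−g₀² + (1 − p₀)² − γ g₀ (1 − p₀)). Then γ_max is bounded over Γ (equivalently, its denominator −g₀² + (1−p₀)² − γg₀(1−p₀) is positive on all of Γ) if and only if (t₊ − t₋)/(t₊ + t₋ − 2t₊t₋) < 1/(ν−1),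 which holds if and only if log(t₊(1−t₋)/((t₊−1)(−t₋))) < log(ν/(ν−2)). Moreover, in this case, for each fixed p₀ the function h₀ ↦ γ_max(p₀, √(h₀ − p₀²)) is convex on the set of h₀ with (p₀, √(h₀ − p₀²)) ∈ Γ. -/
/-- The slope, with respect to the squared variable, of `(u - γ g) / (u² - g² - γ g u)`, compared
across three consecutive points. -/
theorem slope_sq_le {u γ g k l : ℝ} (hu : 0 < u) (hγ : 0 < γ) (hg : 0 < g) (hgk : g < k)
    (hkl : k < l) (hDg : 0 < -g ^ 2 + u ^ 2 - γ * g * u) (hDl : 0 < -l ^ 2 + u ^ 2 - γ * l * u) :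
    (u * (g + k) - γ * (g * k)) / ((g + k) * (-g ^ 2 + u ^ 2 - γ * g * u)) ≤
      (u * (k + l) - γ * (k * l)) / ((k + l) * (-l ^ 2 + u ^ 2 - γ * l * u)) := by
  have hk : 0 < k := hg.trans hgk
  have hl : 0 < l := hk.trans hkl
  have hgu : γ * g < u := by
    by_contra! h
    nlinarith [mul_le_mul_of_nonneg_right h hu.le, pow_pos hg 2]
  have hA : 0 ≤ u * (g + k) - γ * (g * k) := by nlinarith [mul_pos hu hg]
  have key : γ * k ^ 2 * (-g ^ 2 + u ^ 2 - γ * g * u) ≤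
      (l + g + γ * u) * (u * (g + k) - γ * (g * k)) * (k + l) := by
    have h₁ : γ * k * (-g ^ 2 + u ^ 2 - γ * g * u) ≤
        γ * u * (u * (g + k) - γ * (g * k)) := by
      have : 0 ≤ γ * u ^ 2 * g + γ * k * g ^ 2 := by positivity
      linarith
    have h₂ : γ * u * (u * (g + k) - γ * (g * k)) ≤
        (l + g + γ * u) * (u * (g + k) - γ * (g * k)) :=
      mul_le_mul_of_nonneg_right (by linarith) hA
    calc γ * k ^ 2 * (-g ^ 2 + u ^ 2 - γ * g * u)
        = γ * k * (-g ^ 2 + u ^ 2 - γ * g * u) * k := by ring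
      _ ≤ (l + g + γ * u) * (u * (g + k) - γ * (g * k)) * k :=
        mul_le_mul_of_nonneg_right (h₁.trans h₂) hk.le
      _ ≤ _ := mul_le_mul_of_nonneg_left (by linarith) (mul_nonneg (by positivity) hA)
  rw [div_le_div_iff₀ (by positivity) (by positivity)]
  linarith [mul_le_mul_of_nonneg_left key (sub_pos.2 (hgk.trans hkl)).le]

theorem slope_sq_eq {p γ g k : ℝ} (hg : 0 < g) (hgk : g < k)
    (hDg : 0 < -g ^ 2 + (1 - p) ^ 2 - γ * g * (1 - p))
    (hDk : 0 < -k ^ 2 + (1 - p) ^ 2 - γ * k * (1 - p)) :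
    ((k ^ 2 - p ^ 2 + p - γ * k * p) / (-k ^ 2 + (1 - p) ^ 2 - γ * k * (1 - p)) -
      (g ^ 2 - p ^ 2 + p - γ * g * p) / (-g ^ 2 + (1 - p) ^ 2 - γ * g * (1 - p))) /
      (k ^ 2 - g ^ 2) =
    ((1 - p) * (g + k) - γ * (g * k)) / ((g + k) * (-g ^ 2 + (1 - p) ^ 2 - γ * g * (1 - p))) /
      (-k ^ 2 + (1 - p) ^ 2 - γ * k * (1 - p)) := by
  have h₁ : k - g ≠ 0 := (sub_pos.2 hgk).ne'
  have h₂ : g + k ≠ 0 := by linarith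
  rw [show k ^ 2 - g ^ 2 = (k - g) * (g + k) by ring, div_sub_div _ _ hDk.ne' hDg.ne',
    div_div, div_div, div_eq_div_iff
      (mul_ne_zero (mul_ne_zero hDk.ne' hDg.ne') (mul_ne_zero h₁ h₂))
      (mul_ne_zero (mul_ne_zero h₂ hDg.ne') hDk.ne')]
  ring

theorem convexOn_comp_sqrt_of_denom_pos {p γ : ℝ} (hp : p < 1) (hγ : 0 < γ) {S : Set ℝ}
    (hS : Convex ℝ S)
    (hpos : ∀ h ∈ S, 0 < √(h - p ^ 2))
    (hD : ∀ h ∈ S, 0 < -√(h - p ^ 2) ^ 2 + (1 - p) ^ 2 - γ * √(h - p ^ 2) * (1 - p)) :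
    ConvexOn ℝ S (fun h => (√(h - p ^ 2) ^ 2 - p ^ 2 + p - γ * √(h - p ^ 2) * p) /
      (-√(h - p ^ 2) ^ 2 + (1 - p) ^ 2 - γ * √(h - p ^ 2) * (1 - p))) := by
  refine convexOn_of_slope_mono_adjacent hS fun {x y z} hx hz hxy hyz => ?_
  have hy : y ∈ S := hS.ordConnected.out hx hz ⟨hxy.le, hyz.le⟩
  have sq : ∀ h ∈ S, h = √(h - p ^ 2) ^ 2 + p ^ 2 := fun h hh => by
    rw [Real.sq_sqrt (Real.sqrt_pos.1 (hpos h hh)).le]; ring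
  have lt₁ : √(x - p ^ 2) < √(y - p ^ 2) :=
    Real.sqrt_lt_sqrt (Real.sqrt_pos.1 (hpos x hx)).le (by linarith)
  have lt₂ : √(y - p ^ 2) < √(z - p ^ 2) :=
    Real.sqrt_lt_sqrt (Real.sqrt_pos.1 (hpos y hy)).le (by linarith)
  have e₁ : y - x = √(y - p ^ 2) ^ 2 - √(x - p ^ 2) ^ 2 := by linarith [sq x hx, sq y hy]
  have e₂ : z - y = √(z - p ^ 2) ^ 2 - √(y - p ^ 2) ^ 2 := by linarith [sq z hz, sq y hy]
  simp only [e₁, e₂]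
  rw [slope_sq_eq (hpos x hx) lt₁ (hD x hx) (hD y hy),
    slope_sq_eq (hpos y hy) lt₂ (hD y hy) (hD z hz)]
  refine (div_le_div_of_nonneg_right (slope_sq_le (sub_pos.2 hp) hγ (hpos x hx) lt₁ lt₂
    (hD x hx) (hD z hz)) (hD y hy).le).trans_eq ?_
  rw [div_div, div_div, mul_right_comm]

theorem quadrangle_denom_eq {s g u : ℝ} (hs : s ≠ 0) :
    -g ^ 2 + u ^ 2 - (s ^ 2 - 1) / s * g * u = (u - s * g) * (u + g / s) := by
  field_simp
  ring

theorem quadrangle_snd_pos {s a b p g : ℝ} (hs : 1 < s) (hab : 0 < a + b)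
    (h₁ : p + a ≤ s * g) (h₂ : b - p ≤ s * g) : 0 < g := by
  nlinarith

/-- The denominator is positive on the quadrangle iff it is so at the top vertex. -/
theorem quadrangle_denom_pos_iff {s a b : ℝ} (hs : 1 < s) (ha : 0 < a) (hb : 0 < b) (hb1 : b < 1) :
    (∀ p g : ℝ, g / s ≤ p + a → p + a ≤ s * g → g / s ≤ b - p → b - p ≤ s * g →
      0 < -g ^ 2 + (1 - p) ^ 2 - (s ^ 2 - 1) / s * g * (1 - p)) ↔
    s ^ 2 * (a + b) < 2 + a - b := by
  have hs0 : 0 < s := by linarith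
  constructor
  · intro h
    have hle : (a + b) / 2 ≤ s * (s * ((a + b) / 2)) := by
      rw [← mul_assoc]
      exact le_mul_of_one_le_left (by positivity) (by nlinarith)
    have hdiv : s * ((a + b) / 2) / s = (a + b) / 2 := by field_simp
    have := h ((b - a) / 2) (s * ((a + b) / 2)) (by linarith) (by linarith) (by linarith)
      (by linarith)
    rw [quadrangle_denom_eq hs0.ne', hdiv] at this
    have := pos_of_mul_pos_left this (by linarith)
    nlinarith
  · intro h p g h₁ h₂ h₃ h₄
    have hg : 0 < g := quadrangle_snd_pos hs (by linarith) h₂ h₄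
    have hgs : 0 < g / s := by positivity
    rw [quadrangle_denom_eq hs0.ne']
    refine mul_pos ?_ (by linarith)
    have e : s * g = s ^ 2 * (g / s) := by field_simp
    rw [e]
    nlinarith [mul_le_mul_of_nonneg_left h₁ (by nlinarith : 0 ≤ s ^ 2 - 1),
      mul_le_mul_of_nonneg_left h₃ (by nlinarith : 0 ≤ s ^ 2 + 1)]

/-- With Γ the quadrangle (in the (p₀,g₀)-plane) cut out by the two chains of
inequalities and γ_max the upper bound from condition (15), the function γ_max is bounded
over Γ — equivalently, its denominator −g₀² + (1−p₀)² − γg₀(1−p₀) is positive on all of Γ —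
if and only if (t₊−t₋)/(t₊+t₋−2t₊t₋) < 1/(ν−1), i.e. iff the Hilbert distance
log(t₊(1−t₋)/((t₊−1)(−t₋))) is smaller than log(ν/(ν−2)). In that case, for each fixed p₀,
γ_max is convex as a function of h₀ = p₀² + g₀². -/
theorem stmt_14 (ν : ℝ) (hν : 2 < ν) (γ : ℝ) (hγ : γ = (ν - 2) / Real.sqrt (ν - 1))
    (tm tp : ℝ) (htm : tm < 0) (htp : 1 < tp)
    (Γ : Set (ℝ × ℝ))
    (hΓ : Γ = {q : ℝ × ℝ |
      q.2 / Real.sqrt (ν - 1) ≤ q.1 - 1 / tm ∧ q.1 - 1 / tm ≤ Real.sqrt (ν - 1) * q.2 ∧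
      q.2 / Real.sqrt (ν - 1) ≤ -q.1 + 1 / tp ∧ -q.1 + 1 / tp ≤ Real.sqrt (ν - 1) * q.2})
    (gmax : ℝ × ℝ → ℝ)
    (hgmax : ∀ q : ℝ × ℝ, gmax q =
      (q.2 ^ 2 - q.1 ^ 2 + q.1 - γ * q.2 * q.1) /
        (-q.2 ^ 2 + (1 - q.1) ^ 2 - γ * q.2 * (1 - q.1))) :
    ((∀ q ∈ Γ, 0 < -q.2 ^ 2 + (1 - q.1) ^ 2 - γ * q.2 * (1 - q.1)) ↔
      (tp - tm) / (tp + tm - 2 * tp * tm) < 1 / (ν - 1)) ∧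
    ((tp - tm) / (tp + tm - 2 * tp * tm) < 1 / (ν - 1) ↔
      Real.log (tp * (1 - tm) / ((tp - 1) * (-tm))) < Real.log (ν / (ν - 2))) ∧
    ((tp - tm) / (tp + tm - 2 * tp * tm) < 1 / (ν - 1) →
      ∀ p₀ : ℝ, ConvexOn ℝ {h₀ : ℝ | (p₀, Real.sqrt (h₀ - p₀ ^ 2)) ∈ Γ}
        (fun h₀ => gmax (p₀, Real.sqrt (h₀ - p₀ ^ 2)))) := by
  obtain ⟨s, hs, rfl⟩ : ∃ s : ℝ, 1 < s ∧ ν = s ^ 2 + 1 :=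
    ⟨√(ν - 1), Real.lt_sqrt_of_sq_lt (by linarith), by rw [Real.sq_sqrt (by linarith)]; ring⟩
  have hs0 : 0 < s := by linarith
  obtain ⟨a, ha, rfl⟩ : ∃ a : ℝ, 0 < a ∧ tm = -a⁻¹ :=
    ⟨-tm⁻¹, by simpa using htm, by simp [inv_neg]⟩
  obtain ⟨b, hb, rfl⟩ : ∃ b : ℝ, 0 < b ∧ tp = b⁻¹ := ⟨tp⁻¹, by positivity, by simp⟩
  have hb1 : b < 1 := (one_lt_inv₀ hb).1 htp
  have hsq : √(s ^ 2 + 1 - 1) = s := by rw [add_sub_cancel_right, Real.sqrt_sq hs0.le]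
  have hγ' : γ = (s ^ 2 - 1) / s := by rw [hγ, hsq]; ring
  have hγ0 : 0 < γ := by rw [hγ']; exact div_pos (by nlinarith) hs0
  have hmem (p g : ℝ) : (p, g) ∈ Γ ↔
      g / s ≤ p + a ∧ p + a ≤ s * g ∧ g / s ≤ b - p ∧ b - p ≤ s * g := by
    have h₁ : p - 1 / -a⁻¹ = p + a := by field_simp; ring
    have h₂ : -p + 1 / b⁻¹ = b - p := by field_simp; ring
    simp only [hΓ, Set.mem_ofPred_eq, hsq, h₁, h₂]
  have hpos : (∀ q ∈ Γ, 0 < -q.2 ^ 2 + (1 - q.1) ^ 2 - γ * q.2 * (1 - q.1)) ↔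
      s ^ 2 * (a + b) < 2 + a - b := by
    rw [← quadrangle_denom_pos_iff hs ha hb hb1, hγ']
    simp only [Prod.forall, hmem, and_imp]
  have hfrac : (b⁻¹ - -a⁻¹) / (b⁻¹ + -a⁻¹ - 2 * b⁻¹ * -a⁻¹) < 1 / (s ^ 2 + 1 - 1) ↔
      s ^ 2 * (a + b) < 2 + a - b := by
    have e : (b⁻¹ - -a⁻¹) / (b⁻¹ + -a⁻¹ - 2 * b⁻¹ * -a⁻¹) = (a + b) / (2 + a - b) := by
      have h₀ : 2 + a - b ≠ 0 := by linarith
      have h₁ : b⁻¹ - -a⁻¹ = (a + b) * (a⁻¹ * b⁻¹) := by field_simp; ring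
      have h₂ : b⁻¹ + -a⁻¹ - 2 * b⁻¹ * -a⁻¹ = (2 + a - b) * (a⁻¹ * b⁻¹) := by field_simp; ring
      rw [h₁, h₂, mul_div_mul_right _ _ (by positivity)]
    rw [e, add_sub_cancel_right, div_lt_div_iff₀ (by linarith) (by positivity), one_mul, mul_comm]
  refine ⟨hpos.trans hfrac.symm, hfrac.trans ?_, fun h p => ?_⟩
  · have e : b⁻¹ * (1 - -a⁻¹) / ((b⁻¹ - 1) * - -a⁻¹) = (1 + a) / (1 - b) := by
      have h₀ : 1 - b ≠ 0 := by linarith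
      have h₁ : b⁻¹ * (1 - -a⁻¹) = (1 + a) * (a⁻¹ * b⁻¹) := by field_simp; ring
      have h₂ : (b⁻¹ - 1) * - -a⁻¹ = (1 - b) * (a⁻¹ * b⁻¹) := by field_simp
      rw [h₁, h₂, mul_div_mul_right _ _ (by positivity)]
    rw [e, Real.log_lt_log_iff (div_pos (by linarith) (by linarith))
      (div_pos (by linarith) (by linarith)), div_lt_div_iff₀ (by linarith) (by linarith)]
    constructor <;> intro h <;> linarith
  · have hD := hpos.2 (hfrac.1 h)
    have hg : ∀ h₀ ∈ {h₀ : ℝ | (p, √(h₀ - p ^ 2)) ∈ Γ}, 0 < √(h₀ - p ^ 2) := fun h₀ hh =>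
      have ⟨_, h₂, _, h₄⟩ := (hmem _ _).1 hh
      quadrangle_snd_pos hs (by linarith) h₂ h₄
    rcases Set.eq_empty_or_nonempty {h₀ : ℝ | (p, √(h₀ - p ^ 2)) ∈ Γ} with he | ⟨h₀, hh₀⟩
    · rw [he]
      exact ⟨convex_empty, by simp⟩
    have hp : p < 1 := by
      have := div_pos (hg h₀ hh₀) hs0
      linarith [((hmem _ _).1 hh₀).2.2.1]
    have hconv : Convex ℝ {h₀ : ℝ | (p, √(h₀ - p ^ 2)) ∈ Γ} := by
      refine Set.OrdConnected.convex ⟨fun x hx z hz y hy => ?_⟩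
      obtain ⟨-, hx₂, -, hx₄⟩ := (hmem _ _).1 hx
      obtain ⟨hz₁, -, hz₃, -⟩ := (hmem _ _).1 hz
      have hxy : √(x - p ^ 2) ≤ √(y - p ^ 2) := Real.sqrt_le_sqrt (by linarith [hy.1])
      have hyz : √(y - p ^ 2) ≤ √(z - p ^ 2) := Real.sqrt_le_sqrt (by linarith [hy.2])
      have hsxy := mul_le_mul_of_nonneg_left hxy hs0.le
      have hsyz := div_le_div_of_nonneg_right hyz hs0.le
      exact (hmem _ _).2 ⟨by linarith, by linarith, by linarith, by linarith⟩
    simp only [hgmax]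
    exact convexOn_comp_sqrt_of_denom_pos hp hγ0 hconv hg fun h₀ hh => hD _ hh
end
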